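/- arXiv:0705.3501 — 2 statements merged into one kernel-verified Lean document; each statement's English description precedes it below -/
import Mathlib

section
/- Let m, j be integers with 0 ≤ m < j and define the Gaussian g(x) = (2/(√π·2^j·σ))·e^{−x²/(2^j σ)²}. Then the operator on L²(ℝ) sending h to the function x ↦ (1−χⱼ(x))·(g ⋆ (χₘ·h))(x), where ⋆ denotes convolution, has operator norm at most 5·δ₁. -/
open MeasureTheory Real Complex Set Function
open scoped ENNReal

noncomputable section

/-- The error function `erf x = (2/√π) ∫₀ˣ e^{-t²} dt`. -/
def erf' (x : ℝ) : ℝ := (2 / Real.sqrt Real.pi) * ∫ t in (0:ℝ)..x, Real.exp (-t^2)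

/-- The complementary error function `erfc x = 1 - erf x`. -/
def erfc' (x : ℝ) : ℝ := 1 - erf' x

/-- The inverse of the strictly decreasing bijection `erfc' : [0,∞) → (0,1]`. -/
def erfcInv (y : ℝ) : ℝ := Function.invFunOn erfc' (Set.Ici 0) y

/-- The spatial cutoff χ₀(x) = (1/2)[erf((x+3L/4)/σ) − erf((x−3L/4)/σ)]. -/
def chi0 (L σ x : ℝ) : ℝ := (1/2) * (erf' ((x + 3*L/4)/σ) - erf' ((x - 3*L/4)/σ))

/-- The frequency cutoff P₀(k) = (1/2)[erf(σ(k+3kmax/8)) − erf(σ(k−3kmax/8))]. -/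
def P0fun (kmax σ k : ℝ) : ℝ := (1/2) * (erf' (σ*(k + 3*kmax/8)) - erf' (σ*(k - 3*kmax/8)))

/-- The scaled spatial cutoff χₘ(x) = χ₀(2^{-m} x). -/
def chiSc (L σ : ℝ) (m : ℕ) (x : ℝ) : ℝ := chi0 L σ (x / 2^m)

/-- The scaled frequency cutoff Pₘ(k) = P₀(2^m k). -/
def PSc (kmax σ : ℝ) (m : ℕ) (k : ℝ) : ℝ := P0fun kmax σ (2^m * k)

/-- Fourier transform with the convention f̂(k) = (2π)^{-1/2} ∫ f(x) e^{-ikx} dx. -/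
def ft (f : ℝ → ℂ) (k : ℝ) : ℂ :=
  (Real.sqrt (2*Real.pi) : ℂ)⁻¹ * ∫ x : ℝ, Complex.exp (-(Complex.I * k * x)) * f x

/-- Inverse Fourier transform with the convention (2π)^{-1/2} ∫ g(k) e^{ikx} dk. -/
def ift (g : ℝ → ℂ) (x : ℝ) : ℂ :=
  (Real.sqrt (2*Real.pi) : ℂ)⁻¹ * ∫ k : ℝ, Complex.exp (Complex.I * k * x) * g k

/-- The space L²(ℝ, ℂ). -/
abbrev L2 := Lp ℂ 2 (volume : Measure ℝ)

/-- `T` is the bounded Fourier multiplier operator on L² with symbol `m`: on the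
dense set of `f ∈ L¹ ∩ L²` with integrable Fourier transform, `T f = 𝓕⁻¹(m·𝓕f)`.
(This uniquely determines `T` for a bounded symbol.) -/
def IsMultOp (m : ℝ → ℝ) (T : L2 →L[ℂ] L2) : Prop :=
  ∀ f : L2, Integrable (f : ℝ → ℂ) volume → Integrable (ft (f : ℝ → ℂ)) volume →
    (T f : ℝ → ℂ) =ᵐ[volume] ift (fun k => (m k : ℂ) * ft (f : ℝ → ℂ) k)

/-- `T` is the operator of pointwise multiplication by the real function `c`. -/
def IsMulBy (c : ℝ → ℝ) (T : L2 →L[ℂ] L2) : Prop :=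
  ∀ f : L2, (T f : ℝ → ℂ) =ᵐ[volume] fun x => (c x : ℂ) * f x

/-! ### The complementary error function -/

lemma integrable_exp_neg_sq : Integrable fun t : ℝ => Real.exp (-t ^ 2) := by
  simpa using integrable_exp_neg_mul_sq (b := 1) one_pos

lemma erfc'_eq_integral_Ioi (x : ℝ) :
    erfc' x = 2 / √π * ∫ t in Ioi x, Real.exp (-t ^ 2) := by
  have h0 : ∫ t in Ioi (0 : ℝ), Real.exp (-t ^ 2) = √π / 2 := by
    simpa using integral_gaussian_Ioi 1
  have h := intervalIntegral.integral_interval_add_Ioi (a := 0) (b := x)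
    integrable_exp_neg_sq.integrableOn integrable_exp_neg_sq.integrableOn
  have hpi : √π ≠ 0 := by positivity
  rw [erfc', erf', eq_sub_of_add_eq' h, h0]
  field_simp

lemma erfc'_nonneg (x : ℝ) : 0 ≤ erfc' x := by
  rw [erfc'_eq_integral_Ioi]
  have : 0 ≤ ∫ t in Ioi x, Real.exp (-t ^ 2) := integral_nonneg fun t => (Real.exp_pos _).le
  positivity

lemma erfc'_antitone : Antitone erfc' := by
  intro x y hxy
  rw [erfc'_eq_integral_Ioi, erfc'_eq_integral_Ioi]
  refine mul_le_mul_of_nonneg_left ?_ (by positivity)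
  exact setIntegral_mono_set integrable_exp_neg_sq.integrableOn
    (.of_forall fun t => (Real.exp_pos _).le) (Ioi_subset_Ioi hxy).eventuallyLE

lemma erf'_neg (x : ℝ) : erf' (-x) = -erf' x := by
  have h := intervalIntegral.integral_comp_neg (a := 0) (b := x) fun t => Real.exp (-t ^ 2)
  simp only [neg_sq, neg_zero] at h
  rw [erf', erf', h, intervalIntegral.integral_symm]
  ring

lemma erfc'_neg (x : ℝ) : erfc' (-x) = 2 - erfc' x := by
  rw [erfc', erfc', erf'_neg]
  ring

lemma erfc'_zero : erfc' 0 = 1 := by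
  simp [erfc', erf']

lemma continuous_erfc' : Continuous erfc' := by
  have h : Continuous fun x : ℝ => ∫ t in (0 : ℝ)..x, Real.exp (-t ^ 2) :=
    intervalIntegral.continuous_primitive
      (fun _ _ => integrable_exp_neg_sq.intervalIntegrable) 0
  exact continuous_const.sub (continuous_const.mul h)

lemma tendsto_erfc'_atTop : Filter.Tendsto erfc' Filter.atTop (nhds 0) := by
  have h := intervalIntegral_tendsto_integral_Ioi 0
    integrable_exp_neg_sq.integrableOn Filter.tendsto_id
  have h' := (h.const_mul (2 / √π)).const_sub 1
  rwa [← erfc'_eq_integral_Ioi, erfc'_zero, sub_self] at h'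

lemma erfcInv_mem {δ : ℝ} (h0 : 0 < δ) (h1 : δ ≤ 1) :
    0 ≤ erfcInv δ ∧ erfc' (erfcInv δ) = δ := by
  obtain ⟨b, hb, hb0⟩ := ((tendsto_erfc'_atTop.eventually (gt_mem_nhds h0)).and
    (Filter.eventually_ge_atTop 0)).exists
  obtain ⟨s, hs, hsδ⟩ := intermediate_value_Icc' hb0 continuous_erfc'.continuousOn
    ⟨hb.le, h1.trans_eq erfc'_zero.symm⟩
  have hex : ∃ a ∈ Ici (0 : ℝ), erfc' a = δ := ⟨s, hs.1, hsδ⟩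
  exact ⟨invFunOn_mem hex, invFunOn_eq hex⟩

/-! ### The spatial cutoffs -/

lemma chi0_eq_erfc' (L σ x : ℝ) :
    chi0 L σ x = (1 / 2) * (erfc' ((x - 3 * L / 4) / σ) - erfc' ((x + 3 * L / 4) / σ)) := by
  simp only [chi0, erfc']
  ring

lemma chi0_neg (L σ x : ℝ) : chi0 L σ (-x) = chi0 L σ x := by
  rw [chi0, chi0, show (-x + 3 * L / 4) / σ = -((x - 3 * L / 4) / σ) by ring,
    show (-x - 3 * L / 4) / σ = -((x + 3 * L / 4) / σ) by ring, erf'_neg, erf'_neg]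
  ring

lemma chi0_abs (L σ x : ℝ) : chi0 L σ |x| = chi0 L σ x := by
  rcases abs_choice x with h | h <;> rw [h]
  exact chi0_neg L σ x

lemma one_sub_chi0_eq (L σ x : ℝ) :
    1 - chi0 L σ x = (1 / 2) * (erfc' ((3 * L / 4 - x) / σ) + erfc' ((x + 3 * L / 4) / σ)) := by
  rw [chi0_eq_erfc', show (x - 3 * L / 4) / σ = -((3 * L / 4 - x) / σ) by ring, erfc'_neg]
  ring

lemma chi0_nonneg {L σ : ℝ} (hL : 0 ≤ L) (hσ : 0 < σ) (x : ℝ) : 0 ≤ chi0 L σ x := by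
  rw [chi0_eq_erfc']
  have : (x - 3 * L / 4) / σ ≤ (x + 3 * L / 4) / σ := by gcongr; linarith
  linarith [erfc'_antitone this]

lemma chi0_le_one (L σ x : ℝ) : chi0 L σ x ≤ 1 := by
  linarith [one_sub_chi0_eq L σ x, erfc'_nonneg ((3 * L / 4 - x) / σ),
    erfc'_nonneg ((x + 3 * L / 4) / σ)]

lemma one_sub_chi0_le {L σ s x : ℝ} (hσ : 0 < σ) (hs : s * σ ≤ L / 8)
    (hL : 0 ≤ L) (hx : |x| ≤ 5 * L / 8) : 1 - chi0 L σ x ≤ erfc' s := by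
  rw [← chi0_abs, one_sub_chi0_eq]
  have h1 : s ≤ (3 * L / 4 - |x|) / σ := by rw [le_div_iff₀ hσ]; linarith
  have h2 : s ≤ (|x| + 3 * L / 4) / σ := by
    rw [le_div_iff₀ hσ]; linarith [abs_nonneg x]
  linarith [erfc'_antitone h1, erfc'_antitone h2]

lemma chi0_le {L σ s x : ℝ} (hσ : 0 < σ) (hs : s * σ ≤ L / 8)
    (hx : 7 * L / 8 ≤ |x|) : chi0 L σ x ≤ erfc' s / 2 := by
  rw [← chi0_abs, chi0_eq_erfc']
  have h1 : s ≤ (|x| - 3 * L / 4) / σ := by rw [le_div_iff₀ hσ]; linarith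
  linarith [erfc'_antitone h1, erfc'_nonneg ((|x| + 3 * L / 4) / σ)]

/-- If `x` is not in the region where `χⱼ` is close to `1` and `y` is not in the region where
`χₘ` is close to `0`, then `x` and `y` are far apart. -/
lemma one_sub_chiSc_mul_chiSc_le {L σ s : ℝ} (hL : 0 < L) (hσ : 0 < σ)
    (hs : s * σ ≤ L / 8) {m j : ℕ} (hmj : m < j) (x y : ℝ) :
    (1 - chiSc L σ j x) * chiSc L σ m y ≤
      3 / 2 * erfc' s + (Ioi (2 ^ j * σ * s)).indicator 1 |x - y| := by
  have hu0 : 0 ≤ 1 - chiSc L σ j x := sub_nonneg.2 (chi0_le_one _ _ _)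
  have hu1 : 1 - chiSc L σ j x ≤ 1 := sub_le_self _ (chi0_nonneg hL.le hσ _)
  have hv0 : 0 ≤ chiSc L σ m y := chi0_nonneg hL.le hσ _
  have hv1 : chiSc L σ m y ≤ 1 := chi0_le_one _ _ _
  have hδ := erfc'_nonneg s
  have hI : 0 ≤ (Ioi (2 ^ j * σ * s)).indicator (1 : ℝ → ℝ) |x - y| :=
    indicator_nonneg (fun _ _ => zero_le_one) _
  have hj : (0 : ℝ) < 2 ^ j := by positivity
  have hm : (0 : ℝ) < 2 ^ m := by positivity
  by_cases hx : |x / 2 ^ j| ≤ 5 * L / 8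
  · have h : 1 - chiSc L σ j x ≤ erfc' s := one_sub_chi0_le hσ hs hL.le hx
    nlinarith
  by_cases hy : 7 * L / 8 ≤ |y / 2 ^ m|
  · have h : chiSc L σ m y ≤ erfc' s / 2 := chi0_le hσ hs hy
    nlinarith
  rw [abs_div, abs_of_pos hj, not_le, lt_div_iff₀ hj] at hx
  rw [abs_div, abs_of_pos hm, not_le, div_lt_iff₀ hm] at hy
  have hpow : (2 : ℝ) ^ m * 2 ≤ 2 ^ j := by
    rw [← pow_succ]
    exact pow_le_pow_right₀ one_le_two hmj
  have hfar : 2 ^ j * σ * s < |x - y| := by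
    have := abs_sub_abs_le_abs_sub x y
    nlinarith [mul_le_mul_of_nonneg_left hpow hL.le, mul_le_mul_of_nonneg_left hs hj.le,
      mul_pos hL hj]
  rw [indicator_of_mem (mem_Ioi.2 hfar), Pi.one_apply]
  nlinarith

/-! ### The Gaussian of mass two -/

/-- The Gaussian of width `w` and total mass `2`. -/
def gaussianTwo (w x : ℝ) : ℝ := 2 / (√π * w) * Real.exp (-(x ^ 2 / w ^ 2))

lemma gaussianTwo_nonneg {w : ℝ} (hw : 0 < w) (x : ℝ) : 0 ≤ gaussianTwo w x := by
  unfold gaussianTwo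
  positivity

lemma gaussianTwo_abs (w x : ℝ) : gaussianTwo w |x| = gaussianTwo w x := by
  simp [gaussianTwo]

lemma integrable_gaussianTwo {w : ℝ} (hw : 0 < w) : Integrable (gaussianTwo w) := by
  have h := integrable_exp_neg_mul_sq (b := (w ^ 2)⁻¹) (by positivity)
  convert h.const_mul (2 / (√π * w)) using 4
  simp only [gaussianTwo]
  congr 2
  ring

lemma setIntegral_Ioi_gaussianTwo {w : ℝ} (hw : 0 < w) (s : ℝ) :
    ∫ x in Ioi (w * s), gaussianTwo w x = erfc' s := by
  rw [← integral_comp_mul_left_Ioi' _ _ hw, erfc'_eq_integral_Ioi, smul_eq_mul,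
    ← integral_const_mul, ← integral_const_mul]
  congr 1 with t
  have h : (w * t) ^ 2 / w ^ 2 = t ^ 2 := by field_simp
  rw [gaussianTwo, h]
  field_simp

lemma integral_gaussianTwo {w : ℝ} (hw : 0 < w) : ∫ x, gaussianTwo w x = 2 := by
  have h := integral_comp_abs (f := gaussianTwo w)
  have h' := setIntegral_Ioi_gaussianTwo hw 0
  rw [mul_zero, erfc'_zero] at h'
  simpa [gaussianTwo_abs, h'] using h

lemma integral_tail_gaussianTwo {w s : ℝ} (hw : 0 < w) (hs : 0 ≤ s) :
    ∫ x, (Ioi (w * s)).indicator 1 |x| * gaussianTwo w x = 2 * erfc' s := by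
  have h := integral_comp_abs (f := (Ioi (w * s)).indicator (gaussianTwo w))
  rw [setIntegral_indicator measurableSet_Ioi,
    inter_eq_self_of_subset_right (Ioi_subset_Ioi (mul_nonneg hw.le hs)),
    setIntegral_Ioi_gaussianTwo hw] at h
  rw [← h]
  congr 1 with x
  by_cases hx : |x| ∈ Ioi (w * s) <;> simp [hx, gaussianTwo_abs]

lemma measurable_tail (c : ℝ) :
    Measurable fun x : ℝ => (Ioi c).indicator (1 : ℝ → ℝ) |x| :=
  (measurable_one.indicator measurableSet_Ioi).comp measurable_norm

lemma integrable_tail_gaussianTwo {w : ℝ} (hw : 0 < w) (c : ℝ) :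
    Integrable fun x => (Ioi c).indicator 1 |x| * gaussianTwo w x := by
  refine (integrable_gaussianTwo hw).bdd_mul (c := 1) (measurable_tail c).aestronglyMeasurable
    (.of_forall fun x => ?_)
  by_cases hx : |x| ∈ Ioi c <;> simp [hx]

/-! ### Young's inequality -/

/-- Young's convolution inequality `L¹ ⋆ L² → L²`, for `ℝ≥0∞`-valued functions. -/
lemma lintegral_convolution_sq_le {G f : ℝ → ℝ≥0∞} (hG : Measurable G) (hf : Measurable f) :
    ∫⁻ x, (∫⁻ y, G (x - y) * f y) ^ 2 ≤ (∫⁻ x, G x) ^ 2 * ∫⁻ y, f y ^ 2 := by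
  have hmass (x : ℝ) : ∫⁻ y, G (x - y) = ∫⁻ y, G y := lintegral_sub_left_eq_self G x
  have hpt (x : ℝ) : (∫⁻ y, G (x - y) * f y) ^ 2 ≤
      (∫⁻ y, G y) * ∫⁻ y, G (x - y) * f y ^ 2 := by
    have h := ENNReal.lintegral_mul_norm_pow_le (μ := volume) (f := fun y => G (x - y))
      (g := fun y => G (x - y) * f y ^ 2) (by fun_prop) (by fun_prop)
      (p := 1 / 2) (q := 1 / 2) (by norm_num) (by norm_num) (by norm_num)
    have hsqrt (a : ℝ≥0∞) : (a ^ (1 / 2 : ℝ)) ^ 2 = a := by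
      rw [← ENNReal.rpow_natCast, ← ENNReal.rpow_mul]; norm_num
    have hsqrt' (a : ℝ≥0∞) : (a ^ 2) ^ (1 / 2 : ℝ) = a := by
      rw [← ENNReal.rpow_natCast, ← ENNReal.rpow_mul]; norm_num
    have hcongr (y : ℝ) : G (x - y) ^ (1 / 2 : ℝ) * (G (x - y) * f y ^ 2) ^ (1 / 2 : ℝ) =
        G (x - y) * f y := by
      rw [ENNReal.mul_rpow_of_nonneg _ _ (by norm_num), hsqrt', ← mul_assoc, ← sq, hsqrt]
    simp only [hcongr, hmass] at h
    calc (∫⁻ y, G (x - y) * f y) ^ 2 ≤ _ := pow_le_pow_left₀ zero_le h 2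
      _ = _ := by rw [mul_pow, hsqrt, hsqrt]
  calc ∫⁻ x, (∫⁻ y, G (x - y) * f y) ^ 2
      ≤ ∫⁻ x, (∫⁻ y, G y) * ∫⁻ y, G (x - y) * f y ^ 2 := lintegral_mono hpt
    _ = (∫⁻ y, G y) * ∫⁻ x, ∫⁻ y, G (x - y) * f y ^ 2 :=
        lintegral_const_mul _ (Measurable.lintegral_prod_right'
          (f := fun p : ℝ × ℝ => G (p.1 - p.2) * f p.2 ^ 2) (by fun_prop))
    _ = (∫⁻ y, G y) * ∫⁻ y, ∫⁻ x, G (x - y) * f y ^ 2 := by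
        rw [lintegral_lintegral_swap (by fun_prop)]
    _ = (∫⁻ y, G y) * ∫⁻ y, (∫⁻ x, G x) * f y ^ 2 := by
        congr 2 with y
        rw [lintegral_mul_const _ (by fun_prop), lintegral_sub_right_eq_self G y]
    _ = _ := by rw [lintegral_const_mul _ (hf.pow_const 2), sq, mul_assoc]

lemma opNorm_le_of_le_convolution {H : ℝ → ℝ} (hHm : Measurable H) (hH : Integrable H)
    (hH0 : ∀ x, 0 ≤ H x) (T : L2 →L[ℂ] L2)
    (hT : ∀ h : L2, ∀ᵐ x, ‖T h x‖ₑ ≤ ∫⁻ y, ENNReal.ofReal (H (x - y)) * ‖h y‖ₑ) :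
    ‖T‖ ≤ ∫ x, H x := by
  have hI0 : 0 ≤ ∫ x, H x := integral_nonneg hH0
  refine T.opNorm_le_bound hI0 fun h => ?_
  have hsq (u : L2) : eLpNorm u 2 volume ^ 2 = ∫⁻ x, ‖u x‖ₑ ^ 2 := by
    simpa using eLpNorm_nnreal_pow_eq_lintegral (f := u) (μ := volume) (p := 2) two_ne_zero
  have hle : eLpNorm (T h) 2 volume ^ 2 ≤
      (ENNReal.ofReal (∫ x, H x) * eLpNorm h 2 volume) ^ 2 := by
    rw [hsq, mul_pow, hsq, ofReal_integral_eq_lintegral_ofReal hH (.of_forall hH0)]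
    refine (lintegral_mono_ae ?_).trans (lintegral_convolution_sq_le hHm.ennreal_ofReal
      (Lp.stronglyMeasurable h).measurable.enorm)
    filter_upwards [hT h] with x hx
    exact pow_le_pow_left₀ zero_le hx 2
  have hroot := (ENNReal.pow_le_pow_left_iff two_ne_zero).1 hle
  rw [Lp.norm_def, Lp.norm_def, ← ENNReal.toReal_ofReal hI0, ← ENNReal.toReal_mul]
  exact ENNReal.toReal_mono (ENNReal.mul_ne_top ENNReal.ofReal_ne_top (Lp.eLpNorm_ne_top h)) hroot

/-- The operator h ↦ (1−χⱼ)·(g ⋆ (χₘ·h)), with g the Gaussian of width 2^j σ,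
has operator norm at most 5δ₁ (for m < j). -/
theorem stmt7 (L kmax σ δ₁ : ℝ) (hL : 0 < L) (hk : 0 < kmax) (hσ : 0 < σ)
    (hδpos : 0 < δ₁) (hδle : δ₁ ≤ erfc' 1)
    (hσlo : 8 * erfcInv δ₁ / kmax ≤ σ) (hσhi : σ ≤ L / (8 * erfcInv δ₁))
    (hδquarter : δ₁ ≤ 1/4)
    (m j : ℕ) (hmj : m < j)
    (g : ℝ → ℝ)
    (hg : g = fun x => (2 / (Real.sqrt Real.pi * 2^j * σ)) * Real.exp (-(x^2 / (2^j * σ)^2)))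
    (T : L2 →L[ℂ] L2)
    (hT : ∀ h : L2, (T h : ℝ → ℂ) =ᵐ[volume]
      fun x => ((1 - chiSc L σ j x : ℝ) : ℂ)
        * ∫ y : ℝ, (g (x - y) : ℂ) * ((chiSc L σ m y : ℝ) : ℂ) * h y) :
    ‖T‖ ≤ 5 * δ₁ := by
  obtain ⟨hs0, hs⟩ := erfcInv_mem hδpos (by linarith)
  set s := erfcInv δ₁
  have hspos : 0 < s := hs0.lt_of_ne fun h => by
    rw [← h, erfc'_zero] at hs
    linarith
  have hsσ : s * σ ≤ L / 8 := by
    rw [le_div_iff₀ (by positivity)] at hσhi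
    linarith
  have hw : 0 < 2 ^ j * σ := by positivity
  obtain rfl : g = gaussianTwo (2 ^ j * σ) := by
    rw [hg]
    ext x
    rw [gaussianTwo, mul_assoc (√π)]
  set w := 2 ^ j * σ
  let H : ℝ → ℝ := fun x =>
    3 / 2 * δ₁ * gaussianTwo w x + (Ioi (w * s)).indicator 1 |x| * gaussianTwo w x
  have hgm : Measurable (gaussianTwo w) := by unfold gaussianTwo; fun_prop
  have hHm : Measurable H := (hgm.const_mul _).add ((measurable_tail _).mul hgm)
  have hg1 : Integrable fun x => 3 / 2 * δ₁ * gaussianTwo w x :=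
    (integrable_gaussianTwo hw).const_mul _
  have hg2 := integrable_tail_gaussianTwo hw (w * s)
  have hH0 (x : ℝ) : 0 ≤ H x :=
    add_nonneg (mul_nonneg (by positivity) (gaussianTwo_nonneg hw x))
      (mul_nonneg (indicator_nonneg (fun _ _ => zero_le_one) _) (gaussianTwo_nonneg hw x))
  have hHI : ∫ x, H x = 5 * δ₁ := by
    rw [integral_add hg1 hg2, integral_const_mul, integral_gaussianTwo hw,
      integral_tail_gaussianTwo hw hs0, hs]
    ring
  rw [← hHI]
  refine opNorm_le_of_le_convolution hHm (hg1.add hg2) hH0 T fun h => ?_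
  filter_upwards [hT h] with x hx
  rw [hx, enorm_mul]
  calc _ ≤ ‖((1 - chiSc L σ j x : ℝ) : ℂ)‖ₑ *
        ∫⁻ y, ‖(gaussianTwo w (x - y) : ℂ) * ((chiSc L σ m y : ℝ) : ℂ) * h y‖ₑ := by
        gcongr
        exact enorm_integral_le_lintegral_enorm _
    _ = ∫⁻ y, ‖((1 - chiSc L σ j x : ℝ) : ℂ)‖ₑ *
        ‖(gaussianTwo w (x - y) : ℂ) * ((chiSc L σ m y : ℝ) : ℂ) * h y‖ₑ :=
        (lintegral_const_mul' _ _ enorm_ne_top).symm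
    _ ≤ _ := by
        refine lintegral_mono fun y => ?_
        rw [enorm_mul _ (h y), ← mul_assoc, ← enorm_mul]
        gcongr
        rw [← Complex.ofReal_mul, ← Complex.ofReal_mul, ← ofReal_norm, Complex.norm_real]
        refine ENNReal.ofReal_le_ofReal ?_
        have hg0 := gaussianTwo_nonneg hw (x - y)
        have hu : 0 ≤ 1 - chiSc L σ j x := sub_nonneg.2 (chi0_le_one _ _ _)
        have hv : 0 ≤ chiSc L σ m y := chi0_nonneg hL.le hσ _
        rw [Real.norm_of_nonneg (by positivity)]
        have hb := mul_le_mul_of_nonneg_right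
          (one_sub_chiSc_mul_chiSc_le hL hσ hsσ hmj x y) hg0
        rw [hs, add_mul] at hb
        exact le_of_eq_of_le (by ring) hb

end
end

section
/- For every integer M ≥ 0 and every f ∈ L²(ℝ) whose Fourier transform f̂ is (essentially) bounded, ‖P_M f‖²_{L²} ≤ δ₁²·‖f‖²_{L²} + 2^{−M}·kmax·‖f̂‖²_{L^∞}. -/
open MeasureTheory Real Complex Set Function
open scoped ENNReal

noncomputable section

/-- `F` is the Fourier–Plancherel transform on L² (with the convention
f̂(k) = (2π)^{-1/2} ∫ f(x) e^{-ikx} dx on the dense subset L¹ ∩ L²). -/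
def IsFourierOp (F : L2 →L[ℂ] L2) : Prop :=
  ∀ f : L2, Integrable (f : ℝ → ℂ) volume → (F f : ℝ → ℂ) =ᵐ[volume] ft (f : ℝ → ℂ)

lemma hasDerivAt_erf' (x : ℝ) :
    HasDerivAt erf' (2 / Real.sqrt Real.pi * Real.exp (-x ^ 2)) x := by
  have hc : Continuous fun t : ℝ => Real.exp (-t ^ 2) := by fun_prop
  exact (intervalIntegral.integral_hasDerivAt_right (hc.intervalIntegrable _ _)
    (hc.stronglyMeasurableAtFilter _ _) hc.continuousAt).const_mul _

lemma continuous_erf' : Continuous erf' :=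
  continuous_iff_continuousAt.2 fun x => (hasDerivAt_erf' x).continuousAt

lemma monotone_erf' : Monotone erf' :=
  monotone_of_hasDerivAt_nonneg hasDerivAt_erf' fun x => by positivity

lemma tendsto_erf'_atTop : Filter.Tendsto erf' Filter.atTop (nhds 1) := by
  have hi : IntegrableOn (fun t : ℝ => Real.exp (-t ^ 2)) (Ioi 0) := by
    simpa using (integrable_exp_neg_mul_sq (b := 1) one_pos).integrableOn
  have h := (intervalIntegral_tendsto_integral_Ioi 0 hi Filter.tendsto_id).const_mul
    (2 / Real.sqrt Real.pi)
  have hv : ∫ t in Ioi (0 : ℝ), Real.exp (-t ^ 2) = Real.sqrt Real.pi / 2 := by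
    simpa using integral_gaussian_Ioi 1
  rw [hv] at h
  have h1 : 2 / Real.sqrt Real.pi * (Real.sqrt Real.pi / 2) = 1 := by
    have : Real.sqrt Real.pi ≠ 0 := by positivity
    field_simp
  rw [h1] at h
  exact h

lemma erf'_le_one (x : ℝ) : erf' x ≤ 1 :=
  monotone_erf'.ge_of_tendsto tendsto_erf'_atTop x

lemma neg_one_le_erf' (x : ℝ) : -1 ≤ erf' x := by
  linarith [erf'_le_one (-x), erf'_neg x]

lemma erfc'_erfcInv {y : ℝ} (hy : 0 < y) (hy1 : y ≤ erfc' 1) : erfc' (erfcInv y) = y := by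
  have ht : Filter.Tendsto erfc' Filter.atTop (nhds 0) := by
    simpa using! tendsto_erf'_atTop.const_sub 1
  obtain ⟨b, hb1, hb⟩ :=
    ((Filter.eventually_ge_atTop (1 : ℝ)).and (ht.eventually (gt_mem_nhds hy))).exists
  have hc : Continuous erfc' := continuous_const.sub continuous_erf'
  obtain ⟨x, hx, hxy⟩ := intermediate_value_Icc' hb1 hc.continuousOn ⟨hb.le, hy1⟩
  exact Function.invFunOn_eq ⟨x, zero_le_one.trans hx.1, hxy⟩

lemma continuous_PSc (kmax σ : ℝ) (m : ℕ) : Continuous (PSc kmax σ m) := by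
  have := continuous_erf'
  unfold PSc P0fun
  fun_prop

lemma P0fun_nonneg {kmax σ : ℝ} (hk : 0 < kmax) (hσ : 0 < σ) (k : ℝ) :
    0 ≤ P0fun kmax σ k := by
  have : erf' (σ * (k - 3 * kmax / 8)) ≤ erf' (σ * (k + 3 * kmax / 8)) :=
    monotone_erf' (by gcongr; linarith)
  unfold P0fun
  linarith

lemma P0fun_le_one (kmax σ k : ℝ) : P0fun kmax σ k ≤ 1 := by
  unfold P0fun
  linarith [erf'_le_one (σ * (k + 3 * kmax / 8)), neg_one_le_erf' (σ * (k - 3 * kmax / 8))]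

lemma P0fun_le_erfc' {kmax σ k : ℝ} (hσ : 0 < σ) (h : kmax / 2 ≤ |k|) :
    P0fun kmax σ k ≤ erfc' (σ * kmax / 8) / 2 := by
  unfold P0fun erfc'
  rcases le_abs'.1 h with h | h
  · have h1 : erf' (σ * (k + 3 * kmax / 8)) ≤ erf' (-(σ * kmax / 8)) :=
      monotone_erf' (by nlinarith)
    linarith [neg_one_le_erf' (σ * (k - 3 * kmax / 8)), erf'_neg (σ * kmax / 8)]
  · have h1 : erf' (σ * kmax / 8) ≤ erf' (σ * (k - 3 * kmax / 8)) :=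
      monotone_erf' (by nlinarith)
    linarith [erf'_le_one (σ * (k + 3 * kmax / 8))]

lemma continuous_fourier {g : ℝ → ℂ} (h1 : Integrable g) :
    Continuous (FourierTransform.fourier g) := by
  have := (Real.Lp.fourierTransform (memLp_one_iff_integrable.2 h1).toLp).continuous
  rwa [Real.fourierTransform_toLp] at this

/-- On `L¹ ∩ L²`, the `L²` Fourier transform is given by the Fourier integral. -/
lemma coeFn_fourier_toLp {g : ℝ → ℂ} (h1 : Integrable g) (h2 : MemLp g 2) :
    (FourierTransform.fourier (h2.toLp g : L2) : L2) =ᵐ[volume] FourierTransform.fourier g := by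
  refine ae_eq_of_integral_contDiff_smul_eq ((Lp.memLp _).locallyIntegrable one_le_two)
    (continuous_fourier h1).locallyIntegrable fun φ hφ hφc => ?_
  have hφc' : HasCompactSupport (Complex.ofRealCLM ∘ φ) := hφc.comp_left rfl
  have hφ' : ContDiff ℝ (⊤ : ℕ∞) (Complex.ofRealCLM ∘ φ) := by fun_prop
  set ψ : SchwartzMap ℝ ℂ := hφc'.toSchwartzMap hφ' with hψ
  have hψx (x : ℝ) : ψ x = φ x := rfl
  have key := DFunLike.congr_fun
    (Lp.fourier_toTemperedDistribution_eq (h2.toLp g : L2)) ψ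
  rw [TemperedDistribution.fourier_apply, Lp.toTemperedDistribution_apply,
    Lp.toTemperedDistribution_apply] at key
  have flip := VectorFourier.integral_fourierIntegral_smul_eq_flip (L := innerₗ ℝ)
    Real.continuous_fourierChar continuous_inner (ψ.integrable (μ := volume)) h1
  rw [flip_innerₗ] at flip
  have e1 : ∫ x, (FourierTransform.fourier ψ) x • (h2.toLp g : L2) x =
      ∫ x, (FourierTransform.fourier ψ) x • g x :=
    integral_congr_ae (by filter_upwards [h2.coeFn_toLp] with x hx; rw [hx])
  rw [e1] at key
  have := key.symm.trans flip
  simp only [hψx, Complex.coe_smul] at this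
  exact this

lemma eLpNorm_fourier {g : ℝ → ℂ} (h1 : Integrable g) (h2 : MemLp g 2) :
    eLpNorm (FourierTransform.fourier g) 2 volume = eLpNorm g 2 volume := by
  rw [← eLpNorm_congr_ae (coeFn_fourier_toLp h1 h2), ← eLpNorm_congr_ae h2.coeFn_toLp,
    ← Lp.enorm_def, ← Lp.enorm_def, ← ofReal_norm, ← ofReal_norm, Lp.norm_fourier_eq]

lemma eLpNorm_two_comp_mul_left {g : ℝ → ℂ} (hg : Continuous g) {a : ℝ} (ha : a ≠ 0) :
    eLpNorm (fun x => g (a * x)) 2 volume =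
      ENNReal.ofReal (Real.sqrt |a⁻¹|) * eLpNorm g 2 volume := by
  have h := eLpNorm_map_measure (μ := volume) (p := 2) (f := fun x : ℝ => a * x) (g := g)
    hg.aestronglyMeasurable (by fun_prop)
  rw [Real.map_volume_mul_left ha, eLpNorm_smul_measure_of_ne_top (by simp)] at h
  refine h.symm.trans ?_
  rw [smul_eq_mul, Real.sqrt_eq_rpow, ENNReal.ofReal_rpow_of_nonneg (by positivity) (by norm_num)]
  simp

lemma ft_eq_fourier (g : ℝ → ℂ) (k : ℝ) :
    ft g k = (Real.sqrt (2 * Real.pi) : ℂ)⁻¹ *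
      FourierTransform.fourier g ((2 * Real.pi)⁻¹ * k) := by
  rw [ft, Real.fourier_real_eq_integral_exp_smul]
  congr 2 with x
  rw [smul_eq_mul]
  congr 2
  push_cast
  field_simp

lemma ift_eq_ft_neg (g : ℝ → ℂ) (x : ℝ) : ift g x = ft g (-x) := by
  simp only [ift, ft]
  congr 2 with k
  congr 2
  push_cast
  ring

lemma continuous_ft {g : ℝ → ℂ} (h1 : Integrable g) : Continuous (ft g) := by
  have := continuous_fourier h1
  rw [funext (ft_eq_fourier g)]
  fun_prop

lemma eLpNorm_ft {g : ℝ → ℂ} (h1 : Integrable g) (h2 : MemLp g 2) :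
    eLpNorm (ft g) 2 volume = eLpNorm g 2 volume := by
  have : ft g = (Real.sqrt (2 * Real.pi) : ℂ)⁻¹ •
      fun k => FourierTransform.fourier g ((2 * Real.pi)⁻¹ * k) :=
    funext (ft_eq_fourier g)
  rw [this, eLpNorm_const_smul, eLpNorm_two_comp_mul_left (continuous_fourier h1) (by positivity),
    eLpNorm_fourier h1 h2, ← mul_assoc, ← ofReal_norm, ← ENNReal.ofReal_mul (by positivity)]
  have h3 : Real.sqrt (2 * Real.pi) ≠ 0 := by positivity
  rw [inv_inv, norm_inv, Complex.norm_real, Real.norm_of_nonneg (by positivity),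
    abs_of_pos (by positivity), inv_mul_cancel₀ h3]
  simp

lemma eLpNorm_ift {g : ℝ → ℂ} (h1 : Integrable g) (h2 : MemLp g 2) :
    eLpNorm (ift g) 2 volume = eLpNorm g 2 volume := by
  rw [← eLpNorm_ft h1 h2, funext (ift_eq_ft_neg g)]
  exact eLpNorm_comp_measurePreserving (continuous_ft h1).aestronglyMeasurable
    (Measure.measurePreserving_neg volume)

lemma integrable_ft_schwartz (φ : SchwartzMap ℝ ℂ) : Integrable (ft φ) := by
  rw [funext (ft_eq_fourier φ)]
  refine Integrable.const_mul ?_ _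
  exact (FourierTransform.fourier φ : SchwartzMap ℝ ℂ).integrable.comp_mul_left' (by positivity)

lemma ft_congr_ae {f g : ℝ → ℂ} (h : f =ᵐ[volume] g) : ft f = ft g := by
  ext k
  simp only [ft]
  congr 1
  exact integral_congr_ae (by filter_upwards [h] with x hx; rw [hx])

/-- A closed condition on `L²` holds everywhere if it holds for those integrable functions
whose Fourier transform is integrable. -/
lemma L2_induction {p : L2 → Prop} (hp : IsClosed {f | p f})
    (h : ∀ f : L2, Integrable (f : ℝ → ℂ) volume → Integrable (ft (f : ℝ → ℂ)) volume → p f)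
    (f : L2) : p f := by
  refine DenseRange.induction_on
    (SchwartzMap.denseRange_toLpCLM (E := ℝ) (F := ℂ) (μ := volume) (p := 2)
      ENNReal.ofNat_ne_top) f hp fun φ => ?_
  have hφ : ((SchwartzMap.toLpCLM ℝ ℂ 2 volume φ : L2) : ℝ → ℂ) =ᵐ[volume] φ :=
    φ.coeFn_toLp 2 volume
  refine h _ (φ.integrable.congr hφ.symm) ?_
  rw [ft_congr_ae hφ]
  exact integrable_ft_schwartz φ

lemma IsFourierOp.norm_apply {F : L2 →L[ℂ] L2} (hF : IsFourierOp F) (f : L2) :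
    ‖F f‖ = ‖f‖ := by
  refine L2_induction (p := fun f => ‖F f‖ = ‖f‖)
    (isClosed_eq (by fun_prop) (by fun_prop)) (fun f h1 _ => ?_) f
  rw [Lp.norm_def, Lp.norm_def, eLpNorm_congr_ae (hF f h1), eLpNorm_ft h1 (Lp.memLp f)]

lemma IsMultOp.norm_apply {F T : L2 →L[ℂ] L2} (hF : IsFourierOp F) {m : ℝ → ℝ}
    (hm : Continuous m) {C : ℝ} (hC : ∀ k, |m k| ≤ C) (hT : IsMultOp m T) (f : L2) :
    ‖T f‖ = (eLpNorm (fun k => (m k : ℂ) * F f k) 2 volume).toReal := by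
  have hmC : Continuous fun k => (m k : ℂ) := by fun_prop
  have hmb : ∀ᵐ k, ‖(m k : ℂ)‖ ≤ C := .of_forall fun k => by simpa using hC k
  have hmm : MemLp (fun k => (m k : ℂ)) ⊤ volume :=
    memLp_top_of_bound hmC.aestronglyMeasurable C hmb
  let A : L2 →L[ℂ] L2 := (ContinuousLinearMap.mul ℂ ℂ).holderL volume ⊤ 2 2 (hmm.toLp _)
  have hA (g : L2) : (A g : ℝ → ℂ) =ᵐ[volume] fun k => (m k : ℂ) * g k := by
    filter_upwards [(ContinuousLinearMap.mul ℂ ℂ).coeFn_holder (r := 2) (hmm.toLp _) g,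
      hmm.coeFn_toLp] with k h1 h2
    refine h1.trans ?_
    rw [h2]
    rfl
  rw [← eLpNorm_congr_ae (hA (F f)), ← Lp.norm_def]
  refine L2_induction (p := fun f => ‖T f‖ = ‖A (F f)‖)
    (isClosed_eq (by fun_prop) (by fun_prop)) (fun f h1 h1' => ?_) f
  have h2 : MemLp (ft f) 2 := (Lp.memLp (F f)).ae_eq (hF f h1)
  have e : (A (F f) : ℝ → ℂ) =ᵐ[volume] fun k => (m k : ℂ) * ft f k := by
    filter_upwards [hA (F f), hF f h1] with k hk hk'
    rw [hk, hk']
  rw [Lp.norm_def, Lp.norm_def, eLpNorm_congr_ae (hT f h1 h1'), eLpNorm_congr_ae e,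
    eLpNorm_ift (h1'.bdd_mul hmC.aestronglyMeasurable hmb) ((Lp.memLp _).ae_eq e)]

lemma sq_eLpNorm_two_toReal {g : ℝ → ℂ} (hg : MemLp g 2) :
    (eLpNorm g 2 volume).toReal ^ 2 = ∫ x, ‖g x‖ ^ 2 := by
  rw [hg.eLpNorm_eq_integral_rpow_norm two_ne_zero ENNReal.ofNat_ne_top,
    ENNReal.toReal_ofReal (by positivity)]
  simp only [ENNReal.toReal_ofNat, Real.rpow_ofNat]
  rw [← Real.rpow_natCast, ← Real.rpow_mul (by positivity)]
  simp

/-- A multiplier bounded by `1` on `[-a, a]` and by `δ` outside turns a bound on `g` into a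
bound on the mass on `[-a, a]`. -/
lemma sq_eLpNorm_mul_le {m : ℝ → ℝ} (hm : Continuous m) {a δ K : ℝ} (ha : 0 ≤ a)
    (h1 : ∀ k, |m k| ≤ 1) (hδ : ∀ k, a ≤ |k| → |m k| ≤ δ) {g : ℝ → ℂ} (hg : MemLp g 2)
    (hK : ∀ᵐ k, ‖g k‖ ≤ K) :
    (eLpNorm (fun k => (m k : ℂ) * g k) 2 volume).toReal ^ 2 ≤
      δ ^ 2 * (eLpNorm g 2 volume).toReal ^ 2 + 2 * a * K ^ 2 := by
  have hmC : Continuous fun k => (m k : ℂ) := by fun_prop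
  have hmg : MemLp (fun k => (m k : ℂ) * g k) 2 :=
    hg.of_le (hmC.aestronglyMeasurable.mul hg.1) (.of_forall fun k => by
      rw [norm_mul, Complex.norm_real, Real.norm_eq_abs]
      exact mul_le_of_le_one_left (norm_nonneg _) (h1 k))
  have hi : Integrable (fun k => ‖g k‖ ^ 2) := (memLp_two_iff_integrable_sq_norm hg.1).1 hg
  have hi' : Integrable ((Icc (-a) a).indicator fun _ : ℝ => K ^ 2) :=
    (integrable_indicator_iff measurableSet_Icc).2 (integrableOn_const (by simp))
  have hint : ∫ k, (Icc (-a) a).indicator (fun _ : ℝ => K ^ 2) k = 2 * a * K ^ 2 := by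
    rw [integral_indicator measurableSet_Icc, setIntegral_const, smul_eq_mul, Real.volume_real_Icc,
      max_eq_left (by linarith)]
    ring
  rw [sq_eLpNorm_two_toReal hmg, sq_eLpNorm_two_toReal hg, ← hint, ← integral_const_mul,
    ← integral_add (hi.const_mul _) hi']
  refine integral_mono_ae ((memLp_two_iff_integrable_sq_norm hmg.1).1 hmg)
    ((hi.const_mul _).add hi') ?_
  filter_upwards [hK] with k hk
  simp only [norm_mul, Complex.norm_real, Real.norm_eq_abs, mul_pow]
  by_cases hka : k ∈ Icc (-a) a
  · rw [indicator_of_mem hka]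
    have e1 : |m k| ^ 2 * ‖g k‖ ^ 2 ≤ 1 ^ 2 * K ^ 2 := by
      gcongr
      exact h1 k
    have : 0 ≤ δ ^ 2 * ‖g k‖ ^ 2 := by positivity
    linarith
  · rw [indicator_of_notMem hka, add_zero]
    gcongr
    refine hδ k (le_of_lt ?_)
    by_contra! hcon
    exact hka (abs_le.1 hcon)

/-- ‖P_M f‖² ≤ δ₁²‖f‖² + 2^{−M} kmax ‖f̂‖_∞² for f ∈ L² with essentially
bounded Fourier transform. -/
theorem stmt9 (L kmax σ δ₁ : ℝ) (hL : 0 < L) (hk : 0 < kmax) (hσ : 0 < σ)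
    (hδpos : 0 < δ₁) (hδle : δ₁ ≤ erfc' 1)
    (hσlo : 8 * erfcInv δ₁ / kmax ≤ σ) (hσhi : σ ≤ L / (8 * erfcInv δ₁))
    (P : ℕ → (L2 →L[ℂ] L2))
    (hP : ∀ m, IsMultOp (PSc kmax σ m) (P m))
    (F : L2 →L[ℂ] L2) (hF : IsFourierOp F)
    (M : ℕ) (f : L2)
    (hbdd : eLpNorm (F f : ℝ → ℂ) ⊤ volume < ⊤) :
    ‖P M f‖^2 ≤ δ₁^2 * ‖f‖^2
      + (2:ℝ)^(-(M:ℤ)) * kmax * ((eLpNorm (F f : ℝ → ℂ) ⊤ volume).toReal)^2 := by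
  have hinv : erfcInv δ₁ ≤ σ * kmax / 8 := by
    rw [div_le_iff₀ hk] at hσlo
    linarith
  have hδ : erfc' (σ * kmax / 8) ≤ δ₁ := by
    rw [← erfc'_erfcInv hδpos hδle]
    exact sub_le_sub_left (monotone_erf' hinv) 1
  have hnn (k : ℝ) : 0 ≤ PSc kmax σ M k := P0fun_nonneg hk hσ _
  have h1 (k : ℝ) : |PSc kmax σ M k| ≤ 1 := by
    rw [abs_of_nonneg (hnn k)]
    exact P0fun_le_one _ _ _
  have hout (k : ℝ) (h : kmax / 2 / 2 ^ M ≤ |k|) : |PSc kmax σ M k| ≤ δ₁ := by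
    rw [abs_of_nonneg (hnn k)]
    have h2 : kmax / 2 ≤ |2 ^ M * k| := by
      rw [abs_mul, abs_of_pos (by positivity : (0 : ℝ) < 2 ^ M)]
      rwa [div_le_iff₀' (by positivity)] at h
    have := P0fun_le_erfc' hσ h2
    unfold PSc
    linarith
  have hK : ∀ᵐ k, ‖F f k‖ ≤ (eLpNorm (F f : ℝ → ℂ) ⊤ volume).toReal := by
    filter_upwards [enorm_ae_le_eLpNormEssSup (F f : ℝ → ℂ) volume] with k hk
    rw [← toReal_enorm]
    refine ENNReal.toReal_mono hbdd.ne ?_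
    rwa [eLpNorm_exponent_top]
  have key := sq_eLpNorm_mul_le (continuous_PSc kmax σ M) (by positivity) h1 hout
    (Lp.memLp (F f)) hK
  rw [← IsMultOp.norm_apply hF (continuous_PSc kmax σ M) h1 (hP M) f, ← Lp.norm_def,
    hF.norm_apply] at key
  refine key.trans_eq ?_
  rw [zpow_neg, zpow_natCast]
  field_simp

end
end
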